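/- (Refined Bailey pair C(1)) For all integers L, M ≥ 0: Σ_{j∈ℤ} (-1)^j q^{j(3j+1)} U(L,M,3j,2j) = [L+2M choose L]_{q^{1/2}}, where U(L,M,a,b)=T(L,M,a,b)+T(L,M,a+1,b) and the subscript means the Gaussian binomial in base q^{1/2}. -/

import Mathlib

open Finset

noncomputable section

/-- The field of rational functions over ℚ in which the identities are stated. -/
abbrev K : Type := RatFunc ℚ

/-- The variable. -/
def tq : K := RatFunc.X

/-- Gaussian binomial coefficient `[n choose k]` in the variable `p`:
`∏_{j=1}^{k} (1 - p^(n-k+j))/(1 - p^j)` when `0 ≤ k ≤ n`, and `0` otherwise. -/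
def gb (p : K) (n k : ℤ) : K :=
  if 0 ≤ k ∧ k ≤ n then
    ∏ j ∈ Finset.range k.toNat, (1 - p ^ (n - k + 1 + (j : ℤ))) / (1 - p ^ (1 + (j : ℤ)))
  else 0

/-- The refined q-trinomial `T(L,M,a,b)`, in the variable `t = q^{1/2}` (so base-`q`
Gaussian binomials use `t^2`):
`T(L,M,a,b) = Σ_{n=0, n+a+L even}^{L} q^{n²/2} [M choose n][M+b+(L-a-n)/2 choose M+b]
[M-b+(L+a-n)/2 choose M-b]`. -/
def Trf (t : K) (L M a b : ℤ) : K :=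
  ∑ n ∈ Finset.range (L.toNat + 1),
    if Even ((n : ℤ) + a + L) then
      t ^ ((n : ℤ) ^ 2) * gb (t ^ 2) M n * gb (t ^ 2) (M + b + (L - a - n) / 2) (M + b) *
        gb (t ^ 2) (M - b + (L + a - n) / 2) (M - b)
    else 0

/-- `U(L,M,a,b) = T(L,M,a,b) + T(L,M,a+1,b)`. -/
def Uq (t : K) (L M a b : ℤ) : K :=
  Trf t L M a b + Trf t L M (a + 1) b

/-- The `q`-factorial `∏_{i=1}^{n} (1 - p^i)`. -/
def qfac (p : K) (n : ℕ) : K := ∏ i ∈ range n, (1 - p ^ (i + 1))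

/-- `p` is neither zero nor a root of unity. -/
def Generic (p : K) : Prop := p ≠ 0 ∧ ∀ n : ℕ, 0 < n → p ^ n ≠ 1

lemma qfac_succ (p : K) (n : ℕ) : qfac p (n + 1) = qfac p n * (1 - p ^ (n + 1)) :=
  prod_range_succ _ _

lemma Generic.one_sub_ne_zero {p : K} (hp : Generic p) (n : ℕ) : 1 - p ^ (n + 1) ≠ 0 :=
  sub_ne_zero.2 (hp.2 _ n.succ_pos).symm

lemma qfac_ne_zero {p : K} (hp : Generic p) (n : ℕ) : qfac p n ≠ 0 :=
  prod_ne_zero_iff.2 fun i _ => hp.one_sub_ne_zero i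

lemma gb_of_neg (p : K) {n k : ℤ} (h : k < 0) : gb p n k = 0 := by
  rw [gb, if_neg (by omega)]

lemma gb_of_lt (p : K) {n k : ℤ} (h : n < k) : gb p n k = 0 := by
  rw [gb, if_neg (by omega)]

lemma qfac_add (p : K) (a b : ℕ) :
    qfac p (a + b) = qfac p b * ∏ j ∈ range a, (1 - p ^ (b + 1 + j)) := by
  rw [qfac, add_comm a b, prod_range_add, qfac]
  congr 1
  exact prod_congr rfl fun j _ => by ring_nf

lemma gb_add {p : K} (hp : Generic p) (a b : ℕ) :
    gb p ((a : ℤ) + b) a = qfac p (a + b) / (qfac p a * qfac p b) := by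
  rw [gb, if_pos (by omega), qfac_add, prod_div_distrib, Int.toNat_natCast]
  have h1 : ∏ j ∈ range a, (1 - p ^ ((a : ℤ) + b - a + 1 + (j : ℤ))) =
      ∏ j ∈ range a, (1 - p ^ (b + 1 + j)) :=
    prod_congr rfl fun j _ => by
      rw [← zpow_natCast]; congr 2; push_cast; ring
  have h2 : ∏ j ∈ range a, (1 - p ^ (1 + (j : ℤ))) = qfac p a :=
    prod_congr rfl fun j _ => by
      rw [← zpow_natCast]; congr 2; push_cast; ring
  rw [h1, h2]
  have := qfac_ne_zero hp a
  have := qfac_ne_zero hp b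
  field_simp

lemma gb_symm {p : K} (hp : Generic p) (n k : ℤ) : gb p n k = gb p n (n - k) := by
  rcases lt_or_ge k 0 with h | h
  · rw [gb_of_neg p h, gb_of_lt p (by omega)]
  rcases lt_or_ge n k with h' | h'
  · rw [gb_of_lt p h', gb_of_neg p (by omega)]
  obtain ⟨a, rfl⟩ := Int.eq_ofNat_of_zero_le h
  obtain ⟨b, hb⟩ := Int.eq_ofNat_of_zero_le (sub_nonneg.2 h')
  obtain rfl : n = (a : ℤ) + b := by omega
  rw [gb_add hp, show (a : ℤ) + b - a = b by ring, add_comm (a : ℤ), gb_add hp, add_comm a,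
    mul_comm (qfac p a)]

lemma gb_zero_right {p : K} {n : ℤ} (h : 0 ≤ n) : gb p n 0 = 1 := by
  simp [gb, h]

lemma gb_self {p : K} (hp : Generic p) {n : ℤ} (h : 0 ≤ n) : gb p n n = 1 := by
  rw [gb_symm hp, sub_self, gb_zero_right h]

lemma gb_pascal {p : K} (hp : Generic p) {n : ℤ} (hn : 1 ≤ n) (k : ℤ) :
    gb p n k = gb p (n - 1) k + p ^ (n - k) * gb p (n - 1) (k - 1) := by
  rcases lt_or_ge k 0 with h | h
  · simp [gb_of_neg p h, gb_of_neg p (show k - 1 < 0 by omega)]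
  rcases lt_or_ge n k with h' | h'
  · simp [gb_of_lt p h', gb_of_lt p (show n - 1 < k by omega),
      gb_of_lt p (show n - 1 < k - 1 by omega)]
  rcases eq_or_lt_of_le h with rfl | h0
  · simp [gb_zero_right (show 0 ≤ n by omega), gb_zero_right (show 0 ≤ n - 1 by omega),
      gb_of_neg p (show (-1 : ℤ) < 0 by omega)]
  rcases eq_or_lt_of_le h' with rfl | h1
  · simp [gb_self hp (show 0 ≤ k by omega), gb_self hp (show 0 ≤ k - 1 by omega),
      gb_of_lt p (show k - 1 < k by omega)]
  obtain ⟨a, ha⟩ := Int.eq_ofNat_of_zero_le (show 0 ≤ k - 1 by omega)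
  obtain ⟨b, hb⟩ := Int.eq_ofNat_of_zero_le (show 0 ≤ n - k - 1 by omega)
  obtain rfl : k = ((a + 1 : ℕ) : ℤ) := by push_cast; omega
  obtain rfl : n = ((a + 1 : ℕ) : ℤ) + ((b + 1 : ℕ) : ℤ) := by push_cast at *; omega
  rw [gb_add hp, show ((a + 1 : ℕ) : ℤ) + ((b + 1 : ℕ) : ℤ) - 1 = ((a + 1 : ℕ) : ℤ) + (b : ℕ) by
    push_cast; ring, gb_add hp,
    show ((a + 1 : ℕ) : ℤ) + (b : ℕ) = (a : ℤ) + ((b + 1 : ℕ) : ℤ) by push_cast; ring,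
    show ((a + 1 : ℕ) : ℤ) - 1 = a by push_cast; ring, gb_add hp,
    show ((a + 1 : ℕ) : ℤ) + ((b + 1 : ℕ) : ℤ) - ((a + 1 : ℕ) : ℤ) = ((b + 1 : ℕ) : ℤ) by ring,
    zpow_natCast, show a + 1 + (b + 1) = a + b + 1 + 1 by ring, show a + 1 + b = a + b + 1 by ring,
    show a + (b + 1) = a + b + 1 by ring]
  simp only [qfac_succ p (a + b + 1), qfac_succ p a, qfac_succ p b]
  have := qfac_ne_zero hp a
  have := qfac_ne_zero hp b
  have := hp.one_sub_ne_zero a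
  have := hp.one_sub_ne_zero b
  field_simp
  ring

lemma gb_mul_gb {p : K} (hp : Generic p) (n c d : ℤ) :
    gb p (c + n) n * gb p c d = gb p (n + d) n * gb p (c + n) (n + d) := by
  rcases lt_or_ge n 0 with h | hn
  · simp [gb_of_neg p h]
  rcases lt_or_ge d 0 with h | hd
  · simp [gb_of_neg p h, gb_of_lt p (show n + d < n by omega)]
  rcases lt_or_ge c d with h | hc
  · simp [gb_of_lt p h, gb_of_lt p (show c + n < n + d by omega)]
  obtain ⟨n, rfl⟩ := Int.eq_ofNat_of_zero_le hn
  obtain ⟨d, rfl⟩ := Int.eq_ofNat_of_zero_le hd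
  obtain ⟨e, he⟩ := Int.eq_ofNat_of_zero_le (sub_nonneg.2 hc)
  obtain rfl : c = (d : ℤ) + e := by omega
  rw [gb_add hp, gb_add hp, show (d : ℤ) + e + n = n + ((d + e : ℕ) : ℤ) by push_cast; ring,
    gb_add hp, show (n : ℤ) + ((d + e : ℕ) : ℤ) = ((n + d : ℕ) : ℤ) + e by push_cast; ring,
    show (n : ℤ) + (d : ℕ) = ((n + d : ℕ) : ℤ) by push_cast; ring, gb_add hp,
    show n + (d + e) = n + d + e by ring]
  have := qfac_ne_zero hp n
  have := qfac_ne_zero hp d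
  have := qfac_ne_zero hp e
  have := qfac_ne_zero hp (n + d)
  have := qfac_ne_zero hp (d + e)
  field_simp

/-- The right-hand sum of the `q`-Pfaff–Saalschütz summation, in Burge's form. -/
def burgeSum (p : K) (B : ℕ) (a c k l : ℤ) : K :=
  ∑ i ∈ range B, p ^ ((k - i) * (l - i)) * gb p (a + c + i) i * gb p a (k - i) * gb p c (l - i)

lemma burgeSum_succ {p : K} (hp : Generic p) {B : ℕ} {a c : ℤ} (ha : 0 ≤ a) (hc : 0 ≤ c)
    (k l : ℤ) (hk : k < B) :
    burgeSum p B (a + 1) c k l - p ^ (a + 1 + c) * burgeSum p B (a + 1) c (k - 1) (l - 1) =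
      burgeSum p B a c k l + p ^ (a + 1 + l - k) * burgeSum p B a c (k - 1) l := by
  have hp0 := hp.1
  set h : ℤ → ℤ → K := fun k l => ∑ i ∈ range B, p ^ ((k - i) * (l - i)) *
    gb p (a + 1 + c + i) i * gb p a (k - i) * gb p c (l - i) with hh
  have h1 : ∀ k l, burgeSum p B (a + 1) c k l = h k l + p ^ (a + 1 + l - k) * h (k - 1) l := by
    intro k l
    simp only [burgeSum, hh, mul_sum, ← sum_add_distrib]
    refine sum_congr rfl fun i _ => ?_
    rw [gb_pascal hp (show 1 ≤ a + 1 by omega) (k - i), add_sub_cancel_right,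
      show k - i - 1 = k - 1 - i by ring]
    have : p ^ ((k - i) * (l - i)) * p ^ (a + 1 - (k - i)) =
        p ^ (a + 1 + l - k) * p ^ ((k - 1 - i) * (l - i)) := by
      rw [← zpow_add₀ hp0, ← zpow_add₀ hp0]; congr 1; ring
    linear_combination (gb p (a + 1 + c + i) i * gb p a (k - 1 - i) * gb p c (l - i)) * this
  have h2 : ∀ k l : ℤ, k < B → h k l = burgeSum p B a c k l + p ^ (a + 1 + c) * h (k - 1) (l - 1) := by
    intro k l hk
    have key : ∀ i : ℕ, p ^ ((k - i) * (l - i)) * gb p (a + 1 + c + i) i * gb p a (k - i) *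
        gb p c (l - i) = p ^ ((k - i) * (l - i)) * gb p (a + c + i) i * gb p a (k - i) *
        gb p c (l - i) + p ^ (a + 1 + c) * (p ^ ((k - i) * (l - i)) * gb p (a + c + i) (i - 1) *
        gb p a (k - i) * gb p c (l - i)) := by
      intro i
      rw [gb_pascal hp (show 1 ≤ a + 1 + c + i by omega) i, show a + 1 + c + i - 1 = a + c + i by
        ring, show a + 1 + c + (i : ℤ) - i = a + 1 + c by ring]
      ring
    have h3 : ∑ i ∈ range B, p ^ ((k - i) * (l - i)) * gb p (a + c + i) (i - 1) *
        gb p a (k - i) * gb p c (l - i) = h (k - 1) (l - 1) := by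
      rcases B with _ | B
      · simp [hh]
      rw [sum_range_succ', hh]
      simp only
      rw [sum_range_succ]
      congr 1
      · refine sum_congr rfl fun i _ => ?_
        push_cast
        rw [show k - ((i : ℤ) + 1) = k - 1 - i by ring, show l - ((i : ℤ) + 1) = l - 1 - i by ring,
          show a + c + ((i : ℤ) + 1) = a + 1 + c + i by ring, add_sub_cancel_right]
      · rw [gb_of_neg p (show ((0 : ℕ) : ℤ) - 1 < 0 by simp),
          gb_of_neg p (show k - 1 - (B : ℤ) < 0 by push_cast at hk; omega)]
        simp
    rw [← h3]
    simp only [hh]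
    rw [sum_congr rfl fun i _ => key i, sum_add_distrib, mul_sum, burgeSum]
  rw [h1, h1 (k - 1), h2 k l hk, h2 (k - 1) l (by omega)]
  rw [show a + 1 + (l - 1) - (k - 1) = a + 1 + l - k by ring]
  ring

/-- The `q`-Pfaff–Saalschütz summation, in Burge's form. -/
lemma burgeSum_nat {p : K} (hp : Generic p) (a : ℕ) {B : ℕ} {c : ℤ} (hc : 0 ≤ c) :
    ∀ k l : ℤ, k < B → burgeSum p B a c k l = gb p (a + l) k * gb p (c + k) l := by
  have hp0 := hp.1
  induction a with
  | zero =>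
    intro k l hk
    rcases lt_or_ge k 0 with h | h
    · rw [gb_of_neg p h, zero_mul]
      refine sum_eq_zero fun i _ => ?_
      rw [gb_of_neg p (show k - i < 0 by omega)]
      simp
    obtain ⟨k, rfl⟩ := Int.eq_ofNat_of_zero_le h
    rw [burgeSum, sum_eq_single k]
    · have := gb_mul_gb hp k c (l - k)
      rw [show (k : ℤ) + (l - k) = l by ring] at this
      simp [gb_zero_right, this]
    · intro i _ hi
      rcases lt_or_gt_of_ne hi with h' | h'
      · rw [gb_of_lt p (show ((0 : ℕ) : ℤ) < (k : ℤ) - i by push_cast; omega)]; simp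
      · rw [gb_of_neg p (show (k : ℤ) - i < 0 by omega)]; simp
    · intro h'
      simp at h' hk
      omega
  | succ a ih =>
    have main : ∀ n : ℕ, ∀ k l : ℤ, k < n → k < B →
        burgeSum p B (a + 1 : ℕ) c k l = gb p ((a + 1 : ℕ) + l) k * gb p (c + k) l := by
      intro n
      induction n with
      | zero =>
        intro k l h _
        rw [gb_of_neg p (by simpa using h), zero_mul]
        refine sum_eq_zero fun i _ => ?_
        rw [gb_of_neg p (show k - i < 0 by push_cast at h; omega)]
        simp
      | succ n ihn =>
        intro k l hkn hk
        have h1 := burgeSum_succ hp (Int.natCast_nonneg a) hc k l hk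
        rw [ih k l hk, ih (k - 1) l (by omega)] at h1
        push_cast at ihn hkn ⊢
        rw [ihn (k - 1) (l - 1) (by omega) (by omega)] at h1
        rw [sub_eq_iff_eq_add.1 h1]
        rw [show (a : ℤ) + 1 + (l - 1) = a + l by ring, show c + (k - 1) = c + k - 1 by ring]
        rcases lt_or_ge k 0 with h | h
        · simp [gb_of_neg p h, gb_of_neg p (show k - 1 < 0 by omega)]
        rcases lt_or_ge l 0 with h' | h'
        · simp [gb_of_neg p h', gb_of_neg p (show l - 1 < 0 by omega)]
        rw [gb_pascal hp (show 1 ≤ (a : ℤ) + 1 + l by omega) k,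
          show (a : ℤ) + 1 + l - 1 = a + l by ring]
        rcases eq_or_lt_of_le h with rfl | h0
        · simp [gb_of_neg p (show (-1 : ℤ) < 0 by omega)]
        have h2 := gb_pascal hp (show 1 ≤ c + k by omega) l
        have h3 : p ^ ((a : ℤ) + 1 + l - k) * p ^ (c + k - l) = p ^ ((a : ℤ) + 1 + c) := by
          rw [← zpow_add₀ hp0]; congr 1; ring
        rw [← h3]
        linear_combination -(p ^ ((a : ℤ) + 1 + l - k) * gb p (a + l) (k - 1)) * h2
    intro k l hk
    exact main B k l hk hk

lemma burge {p : K} (hp : Generic p) {B : ℕ} {a c k l : ℤ} (hk : k < B)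
    (h : 0 ≤ a ∧ 0 ≤ c ∨ gb p (a + l) k * gb p (c + k) l = 0) :
    gb p (a + l) k * gb p (c + k) l = burgeSum p B a c k l := by
  by_cases hac : 0 ≤ a ∧ 0 ≤ c
  · obtain ⟨a, rfl⟩ := Int.eq_ofNat_of_zero_le hac.1
    exact (burgeSum_nat hp a hac.2 k l hk).symm
  · rw [h.resolve_left hac]
    refine (sum_eq_zero fun i _ => ?_).symm
    rcases not_and_or.1 hac with h' | h'
    · rcases lt_or_ge (k - i) 0 with h'' | h''
      · rw [gb_of_neg p h'']; simp
      · rw [gb_of_lt p (show a < k - i by omega)]; simp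
    · rcases lt_or_ge (l - i) 0 with h'' | h''
      · rw [gb_of_neg p h'']; simp
      · rw [gb_of_lt p (show c < l - i by omega)]; simp

/-- The product `∏_{i=0}^{n-1} (1 + a p^i X)`. -/
def qProd (p a : K) (n : ℕ) : Polynomial K :=
  ∏ i ∈ range n, (1 + Polynomial.C (a * p ^ i) * Polynomial.X)

/-- The `q`-binomial theorem. -/
lemma coeff_qProd {p : K} (hp : Generic p) (a : K) (n k : ℕ) :
    (qProd p a n).coeff k = p ^ k.choose 2 * a ^ k * gb p n k := by
  induction n generalizing k with
  | zero =>
    rcases k with _ | k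
    · simp [qProd, gb_zero_right]
    · rw [gb_of_lt p (by push_cast; omega)]
      simp [qProd, Polynomial.coeff_one]
  | succ n ih =>
    rw [qProd, prod_range_succ, ← qProd, mul_add, mul_one, Polynomial.coeff_add, ← mul_assoc,
      ih]
    rcases k with _ | k
    · simp [gb_zero_right]
      rw [gb_zero_right (by omega)]
    · rw [Polynomial.coeff_mul_X, Polynomial.coeff_mul_C, ih,
        gb_pascal hp (n := ((n + 1 : ℕ) : ℤ)) (by push_cast; omega)]
      push_cast
      rw [add_sub_cancel_right, add_sub_cancel_right, add_sub_add_right_eq_sub,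
        zpow_sub₀ hp.1, zpow_natCast, zpow_natCast, Nat.choose_succ_succ' k 1, Nat.choose_one_right,
        pow_add]
      have := pow_ne_zero k hp.1
      field_simp
      ring

lemma coeff_X_pow_mul_qProd {p : K} (hp : Generic p) (a : K) (n c k : ℕ) :
    (Polynomial.X ^ c * qProd p a n).coeff k =
      p ^ (k - c).choose 2 * a ^ (k - c) * gb p n ((k : ℤ) - c) := by
  rw [Polynomial.coeff_X_pow_mul']
  split_ifs with h
  · rw [coeff_qProd hp, Nat.cast_sub h]
  · rw [gb_of_neg p (by omega), mul_zero]

lemma choose_two_add (a b : ℕ) : (a + b).choose 2 = a.choose 2 + b.choose 2 + a * b := by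
  induction b with
  | zero => simp
  | succ b ih =>
    rw [← add_assoc, Nat.choose_succ_succ' (a + b) 1, ih, Nat.choose_succ_succ' b 1]
    simp only [Nat.choose_one_right]
    ring

lemma coeff_qProd_mul_qProd {p : K} (hp : Generic p) (n n' c s : ℕ) :
    ((Polynomial.X ^ c * qProd p 1 n) * (Polynomial.X ^ c * qProd p (p ^ 2) n')).coeff s =
      p ^ (c * (s - 2 * c) + c ^ 2 + 2 * c + (s - 2 * c).choose 2 + 2 * (s - 2 * c)) *
        ∑ m ∈ range (s + 1), p ^ ((m : ℤ) ^ 2 - s * m - 2 * m) *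
          (gb p n (m - c) * gb p n' (s - m - c)) := by
  rw [Polynomial.coeff_mul, Finset.Nat.sum_antidiagonal_eq_sum_range_succ_mk, mul_sum]
  refine sum_congr rfl fun m hm => ?_
  have hms : m ≤ s := Nat.lt_succ_iff.1 (mem_range.1 hm)
  rw [coeff_X_pow_mul_qProd hp, coeff_X_pow_mul_qProd hp, Nat.cast_sub hms]
  rcases lt_or_ge m c with h | h
  · simp [gb_of_neg p (show (m : ℤ) - c < 0 by omega)]
  rcases lt_or_ge (s - m) c with h' | h'
  · simp [gb_of_neg p (show (s : ℤ) - m - c < 0 by omega)]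
  obtain ⟨w, rfl⟩ := Nat.exists_eq_add_of_le h
  obtain ⟨w', hw⟩ := Nat.exists_eq_add_of_le h'
  obtain rfl : s = c + w + (c + w') := by omega
  have e : p ^ (w.choose 2) * (p ^ (w'.choose 2) * (p ^ 2) ^ w') =
      p ^ (c * (w + w') + c ^ 2 + 2 * c + (w + w').choose 2 + 2 * (w + w')) *
      p ^ (((c + w : ℕ) : ℤ) ^ 2 - ((c + w + (c + w') : ℕ) : ℤ) * ((c + w : ℕ) : ℤ)
        - 2 * ((c + w : ℕ) : ℤ)) := by
    rw [← pow_mul]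
    simp only [← zpow_natCast, ← zpow_add₀ hp.1, choose_two_add]
    congr 1
    push_cast
    ring
  rw [show c + w - c = w by omega, show c + w + (c + w') - (c + w) - c = w' by omega,
    show c + w + (c + w') - 2 * c = w + w' by omega, one_pow, mul_one]
  linear_combination (gb p n (((c + w : ℕ) : ℤ) - c) *
    gb p n' (((c + w + (c + w') : ℕ) : ℤ) - ((c + w : ℕ) : ℤ) - c)) * e

lemma qProd_mul_qProd (p : K) (n : ℕ) :
    qProd p 1 (n + 4) * qProd p (p ^ 2) n = qProd p 1 (n + 2) * qProd p (p ^ 2) (n + 2) := by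
  simp only [qProd, prod_range_succ _ (n + 3), prod_range_succ _ (n + 2), prod_range_succ _ (n + 1),
    prod_range_succ _ n, show n + 4 = n + 3 + 1 from rfl]
  rw [show (1 : K) * p ^ (n + 2) = p ^ 2 * p ^ n by ring,
    show (1 : K) * p ^ (n + 3) = p ^ 2 * p ^ (n + 1) by ring]
  ring

lemma sum_gb_mul_gb_sub {p : K} (hp : Generic p) (n c s : ℕ) :
    ∑ m ∈ range (s + 1), p ^ ((m : ℤ) ^ 2 - s * m - 2 * m) *
      (gb p (n + 2 : ℕ) (m - c) * gb p (n + 2 : ℕ) (s - m - c) -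
        gb p (n + 4 : ℕ) (m - c) * gb p n (s - m - c)) = 0 := by
  simp only [mul_sub, sum_sub_distrib]
  rw [sub_eq_zero]
  refine mul_left_cancel₀ (pow_ne_zero _ hp.1) ((coeff_qProd_mul_qProd hp (n + 2) (n + 2) c s).symm.trans
    (Eq.trans ?_ (coeff_qProd_mul_qProd hp (n + 4) n c s)))
  congr 1
  rw [mul_mul_mul_comm, mul_mul_mul_comm _ (qProd p 1 (n + 4)), qProd_mul_qProd]

lemma gb_mul_gb_eq_zero (p : K) {n k n' k' : ℤ} (h : k < 0 ∨ n < k ∨ k' < 0 ∨ n' < k') :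
    gb p n k * gb p n' k' = 0 := by
  rcases h with h | h | h | h
  · rw [gb_of_neg p h, zero_mul]
  · rw [gb_of_lt p h, zero_mul]
  · rw [gb_of_neg p h, mul_zero]
  · rw [gb_of_lt p h, mul_zero]

/-- The difference of two families of products of Gaussian binomials that is summed
in the innermost step. -/
def innerSum (p : K) (s : ℕ) (l : ℤ) : K :=
  ∑ m ∈ range (s + 1), p ^ (2 * (m : ℤ) ^ 2 - 2 * s * m - 2 * m) *
    (gb p (s - m) (m - l) * gb p m (s - m - l) - gb p (s + 2 - m) (m - l) * gb p (m - 2) (s - m - l))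

lemma innerSum_of_neg (p : K) (s : ℕ) {l : ℤ} (hl : l < 0) : innerSum p s l = 0 := by
  refine sum_eq_zero fun m _ => ?_
  rw [gb_mul_gb_eq_zero p (by omega), gb_mul_gb_eq_zero p (by omega), sub_zero, mul_zero]

lemma innerSum_of_two_le {p : K} (hp : Generic p) (s n : ℕ) : innerSum p s (n + 2) = 0 := by
  have key : ∀ m ∈ range (s + 1), p ^ (2 * (m : ℤ) ^ 2 - 2 * s * m - 2 * m) *
      (gb p (s - m) (m - (n + 2)) * gb p m (s - m - (n + 2)) -
        gb p (s + 2 - m) (m - (n + 2)) * gb p (m - 2) (s - m - (n + 2))) =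
      ∑ i ∈ range (s + 1), p ^ (-((n : ℤ) + 2 + i) * s + ((n : ℤ) + 2 + i) ^ 2) *
        gb p (2 * (n + 2) + i) i * (p ^ ((m : ℤ) ^ 2 - s * m - 2 * m) *
        (gb p (n + 2 : ℕ) (m - (n + 2 + i : ℕ)) * gb p (n + 2 : ℕ) (s - m - (n + 2 + i : ℕ)) -
        gb p (n + 4 : ℕ) (m - (n + 2 + i : ℕ)) * gb p n (s - m - (n + 2 + i : ℕ)))) := by
    intro m hm
    have hk : (m : ℤ) - (n + 2) < (s + 1 : ℕ) := by have := mem_range.1 hm; omega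
    have h1 := burge hp (a := n + 2) (c := n + 2) (l := s - m - (n + 2)) hk (Or.inl (by omega))
    have h2 := burge hp (a := n + 4) (c := n) (l := s - m - (n + 2)) hk (Or.inl (by omega))
    rw [show (n : ℤ) + 2 + (s - m - (n + 2)) = s - m by ring,
      show (n : ℤ) + 2 + (m - (n + 2)) = m by ring] at h1
    rw [show (n : ℤ) + 4 + (s - m - (n + 2)) = s + 2 - m by ring,
      show (n : ℤ) + (m - (n + 2)) = m - 2 by ring] at h2
    rw [h1, h2, burgeSum, burgeSum, ← sum_sub_distrib, mul_sum]
    refine sum_congr rfl fun i _ => ?_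
    have e : p ^ (2 * (m : ℤ) ^ 2 - 2 * s * m - 2 * m) *
        p ^ (((m : ℤ) - (n + 2) - i) * (s - m - (n + 2) - i)) =
        p ^ (-((n : ℤ) + 2 + i) * s + ((n : ℤ) + 2 + i) ^ 2) *
        p ^ ((m : ℤ) ^ 2 - s * m - 2 * m) := by
      simp only [← zpow_add₀ hp.1]
      congr 1
      ring
    push_cast
    rw [show (n : ℤ) + 2 + (n + 2) + i = 2 * (n + 2) + i by ring,
      show (n : ℤ) + 4 + n + i = 2 * (n + 2) + i by ring,
      show (m : ℤ) - (n + 2) - i = m - (n + 2 + i) by ring,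
      show (s : ℤ) - m - (n + 2) - i = s - m - (n + 2 + i) by ring] at *
    linear_combination (gb p (2 * (n + 2) + i) i * (gb p (n + 2) (m - (n + 2 + i)) *
      gb p (n + 2) (s - m - (n + 2 + i)) -
      gb p (n + 4) (m - (n + 2 + i)) * gb p n (s - m - (n + 2 + i)))) * e
  rw [innerSum, sum_congr rfl key, sum_comm]
  refine sum_eq_zero fun i _ => ?_
  rw [← mul_sum, sum_gb_mul_gb_sub hp, mul_zero]

lemma innerSum_zero {p : K} (hp : Generic p) {s : ℕ} (hs : 1 ≤ s) : innerSum p s 0 = 0 := by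
  simp only [innerSum, mul_sub, sum_sub_distrib, sub_zero]
  rcases Nat.even_or_odd' s with ⟨r, rfl | rfl⟩
  · rw [sum_eq_single_of_mem r (by simp; omega) fun m _ hm => ?_,
      sum_eq_single_of_mem (r + 1) (by simp; omega) fun m _ hm => ?_]
    · push_cast
      rw [show 2 * (r : ℤ) - r = r by ring, show 2 * (r : ℤ) + 2 - (r + 1) = r + 1 by ring,
        show 2 * (r : ℤ) - (r + 1) = r + 1 - 2 by ring, gb_self hp (by omega),
        gb_self hp (by omega), gb_self hp (by omega), sub_eq_zero]
      congr 2
      ring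
    · rw [gb_mul_gb_eq_zero p (by push_cast; omega), mul_zero]
    · rw [gb_mul_gb_eq_zero p (by push_cast; omega), mul_zero]
  · rw [sum_eq_zero fun m _ => ?_, sum_eq_zero fun m _ => ?_, sub_zero]
    · rw [gb_mul_gb_eq_zero p (by push_cast; omega), mul_zero]
    · rw [gb_mul_gb_eq_zero p (by push_cast; omega), mul_zero]

lemma gb_one_right {p : K} (hp : Generic p) (n : ℕ) : gb p n 1 = (1 - p ^ n) / (1 - p) := by
  rcases n with _ | n
  · rw [gb_of_lt p (by simp)]; simp
  · have := gb_add hp 1 n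
    have h := qfac_ne_zero hp n
    rw [add_comm 1 n, qfac_succ] at this
    rw [show ((n + 1 : ℕ) : ℤ) = (1 : ℕ) + n by push_cast; ring,
      show gb p ((1 : ℕ) + n) 1 = gb p ((1 : ℕ) + n) (1 : ℕ) by simp, this,
      show qfac p 1 = 1 - p by simp [qfac]]
    field_simp

lemma two_mul_choose_two (n : ℕ) : 2 * (n.choose 2 : ℤ) = n * (n - 1) := by
  induction n with
  | zero => simp
  | succ n ih =>
    rw [Nat.choose_succ_succ' n 1, Nat.choose_one_right]
    push_cast
    linarith

lemma innerSum_one {p : K} (hp : Generic p) {s : ℕ} (hs : 2 ≤ s) :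
    innerSum p s 1 = (-1) ^ s * p ^ (-((s + 1).choose 2 + 1 : ℤ)) := by
  have hp0 := hp.1
  have hp1 : 1 - p ≠ 0 := by simpa using hp.one_sub_ne_zero 0
  have hc := two_mul_choose_two (s + 1)
  simp only [innerSum, mul_sub, sum_sub_distrib]
  rcases Nat.even_or_odd' s with ⟨r, rfl | rfl⟩
  · obtain ⟨r, rfl⟩ : ∃ t, r = t + 1 := ⟨r - 1, by omega⟩
    rw [sum_eq_single_of_mem (r + 1) (mem_range.2 (by omega)) fun m _ hm => ?_,
      sum_eq_single_of_mem (r + 2) (mem_range.2 (by omega)) fun m _ hm => ?_]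
    · push_cast at hc ⊢
      rw [show 2 * ((r : ℤ) + 1) - (r + 1) = r + 1 by ring,
        show 2 * ((r : ℤ) + 1) + 2 - (r + 2) = r + 2 by ring,
        show 2 * ((r : ℤ) + 1) - (r + 2) - 1 = r - 1 by ring,
        show (r : ℤ) + 2 - 2 = r by ring, gb_symm hp (r + 1), gb_symm hp (r + 2), gb_symm hp r,
        show (r : ℤ) + 1 - (r + 1 - 1) = 1 by ring, show (r : ℤ) + 2 - (r + 2 - 1) = 1 by ring,
        show (r : ℤ) - (r - 1) = 1 by ring]
      have h1 := gb_one_right hp (r + 1)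
      have h2 := gb_one_right hp (r + 2)
      have h3 := gb_one_right hp r
      push_cast at h1 h2 h3
      rw [h1, h2, h3, pow_mul, neg_one_sq, one_pow, one_mul,
        show 2 * ((r : ℤ) + 1) ^ 2 - 2 * (2 * (r + 1)) * (r + 1) - 2 * (r + 1) =
          -(2 * (r + 1) * (r + 2)) by ring,
        show 2 * ((r : ℤ) + 2) ^ 2 - 2 * (2 * (r + 1)) * (r + 2) - 2 * (r + 2) =
          -(2 * (r + 1) * (r + 2)) by ring,
        show -(((2 * (r + 1) + 1).choose 2 : ℤ) + 1) = -(2 * (r + 1) * (r + 2)) + r by linarith,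
        zpow_add₀ hp0, zpow_natCast]
      field_simp
      ring
    · rw [gb_mul_gb_eq_zero p (by push_cast; omega), mul_zero]
    · rw [gb_mul_gb_eq_zero p (by push_cast; omega), mul_zero]
  · obtain ⟨u, rfl⟩ : ∃ u, r = u + 1 := ⟨r - 1, by omega⟩
    rw [sum_eq_add_of_mem (u + 1) (u + 2) (mem_range.2 (by omega)) (mem_range.2 (by omega)) (by omega)
        fun m _ hm => ?_,
      sum_eq_add_of_mem (u + 2) (u + 3) (mem_range.2 (by omega)) (mem_range.2 (by omega)) (by omega)
        fun m _ hm => ?_]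
    · push_cast at hc ⊢
      have h1 := gb_one_right hp (u + 1)
      have h2 := gb_one_right hp (u + 2)
      have h3 := gb_pascal hp (show (1 : ℤ) ≤ u + 2 by omega) 2
      have h4 := gb_pascal hp (show (1 : ℤ) ≤ u + 3 by omega) 2
      push_cast at h1 h2
      rw [show (u : ℤ) + 2 - 1 = u + 1 by ring, show (u : ℤ) + 2 - 2 = u by ring,
        show (2 : ℤ) - 1 = 1 by ring, h1, zpow_natCast] at h3
      rw [show (u : ℤ) + 3 - 1 = u + 2 by ring, show (u : ℤ) + 3 - 2 = u + 1 by ring,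
        show (2 : ℤ) - 1 = 1 by ring, h2, zpow_add_one₀ hp0, zpow_natCast] at h4
      rw [show 2 * ((u : ℤ) + 1) + 1 - (u + 1) = u + 2 by ring,
        show 2 * ((u : ℤ) + 1) + 1 - (u + 2) = u + 1 by ring,
        show 2 * ((u : ℤ) + 1) + 1 + 2 - (u + 2) = u + 3 by ring,
        show 2 * ((u : ℤ) + 1) + 1 + 2 - (u + 3) = u + 2 by ring,
        show 2 * ((u : ℤ) + 1) + 1 - (u + 3) - 1 = u - 1 by ring,
        show (u : ℤ) + 2 - 2 = u by ring, show (u : ℤ) + 2 - 1 = u + 1 by ring,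
        show (u : ℤ) + 1 - 1 = u by ring, show (u : ℤ) + 3 - 2 = u + 1 by ring,
        show (u : ℤ) + 3 - 1 = u + 2 by ring, gb_self hp (show (0 : ℤ) ≤ u by omega),
        gb_self hp (show (0 : ℤ) ≤ u + 1 by omega), gb_self hp (show (0 : ℤ) ≤ u + 2 by omega),
        gb_symm hp (u + 2) u, gb_symm hp (u + 3) (u + 1), gb_symm hp (u + 1) (u - 1),
        show (u : ℤ) + 2 - u = 2 by ring, show (u : ℤ) + 3 - (u + 1) = 2 by ring,
        show (u : ℤ) + 1 - (u - 1) = 2 by ring, h4, h3,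
        show 2 * ((u : ℤ) + 1) ^ 2 - 2 * (2 * (u + 1) + 1) * (u + 1) - 2 * (u + 1) =
          -(2 * (u + 2) ^ 2) + 2 by ring,
        show 2 * ((u : ℤ) + 2) ^ 2 - 2 * (2 * (u + 1) + 1) * (u + 2) - 2 * (u + 2) =
          -(2 * (u + 2) ^ 2) by ring,
        show 2 * ((u : ℤ) + 3) ^ 2 - 2 * (2 * (u + 1) + 1) * (u + 3) - 2 * (u + 3) =
          -(2 * (u + 2) ^ 2) + 2 by ring,
        show -(((2 * (u + 1) + 1 + 1).choose 2 : ℤ) + 1) = -(2 * (u + 2) ^ 2) + (u + 1 : ℕ) by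
          push_cast; linarith, pow_succ (-1 : K), pow_mul (-1 : K), neg_one_sq, one_pow,
        zpow_add₀ hp0, zpow_add₀ hp0, zpow_natCast, show (2 : ℤ) = (2 : ℕ) by rfl, zpow_natCast]
      field_simp
      ring
    · rw [gb_mul_gb_eq_zero p (by push_cast; omega), mul_zero]
    · rw [gb_mul_gb_eq_zero p (by push_cast; omega), mul_zero]

/-- The summand, indexed by `j`, that remains after Burge's transform has been applied to
the two `q`-trinomials; `e = 0, 1` distinguishes `T(L,M,3j,2j)` from `T(L,M,3j+1,2j)`. -/
def burgeTerm (p : K) (M e s j : ℤ) : K :=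
  if Even (s + j + e) then
    (-1) ^ j * p ^ (j * (3 * j + 1) + (s - 3 * j - e) / 2 * ((s + 3 * j + e) / 2)) *
      (gb p (M - j - e) ((s - 3 * j - e) / 2) * gb p (M + j + e) ((s + 3 * j + e) / 2))
  else 0

lemma burgeTerm_ne_zero {p : K} {M e s j : ℤ} (h : burgeTerm p M e s j ≠ 0) :
    Even (s + j + e) ∧ 0 ≤ (s - 3 * j - e) / 2 ∧ (s - 3 * j - e) / 2 ≤ M - j - e ∧
      0 ≤ (s + 3 * j + e) / 2 ∧ (s + 3 * j + e) / 2 ≤ M + j + e := by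
  unfold burgeTerm at h
  split_ifs at h with hpar
  · refine ⟨hpar, ?_⟩
    by_contra hc
    exact h (by rw [gb_mul_gb_eq_zero p (by omega), mul_zero])
  · exact absurd rfl h

lemma burgeTerm_eq_zero {p : K} {M e s j : ℤ} (h : ¬ (Even (s + j + e) ∧
    0 ≤ (s - 3 * j - e) / 2 ∧ (s - 3 * j - e) / 2 ≤ M - j - e ∧
      0 ≤ (s + 3 * j + e) / 2 ∧ (s + 3 * j + e) / 2 ≤ M + j + e)) :
    burgeTerm p M e s j = 0 := by
  by_contra hc
  exact h (burgeTerm_ne_zero hc)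

lemma sum_burgeTerm_reindex (p : K) (M s : ℕ) {e : ℤ} (he : e = 0 ∨ e = 1) :
    ∑ j ∈ Icc (-(M : ℤ)) M, burgeTerm p M e s j =
      ∑ m ∈ range (s + 1), burgeTerm p M e s (s + e - 2 * m) := by
  symm
  refine sum_bij_ne_zero (fun m _ _ => (s : ℤ) + e - 2 * m) ?_ ?_ ?_ fun _ _ _ => rfl
  · intro m _ h
    have := burgeTerm_ne_zero h
    rw [mem_Icc]
    omega
  · intro m _ _ m' _ _ h
    omega
  · intro j _ h
    obtain ⟨⟨r, hr⟩, h⟩ := burgeTerm_ne_zero h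
    obtain ⟨m, hm⟩ := Int.eq_ofNat_of_zero_le (show 0 ≤ s + e - r by omega)
    have hj : (s : ℤ) + e - 2 * m = j := by omega
    exact ⟨m, mem_range.2 (by omega), hj ▸ ‹_›, hj⟩

lemma neg_one_zpow_sub_two_mul (a m : ℤ) : (-1 : K) ^ (a - 2 * m) = (-1) ^ a := by
  rw [zpow_sub₀ (by simp), (even_two_mul m).neg_one_zpow, div_one]

lemma burgeTerm_eq_sum {p : K} (hp : Generic p) {M s m : ℕ} {e : ℤ} (he : e = 0 ∨ e = 1)
    (hs : 2 ≤ s) (hm : m ≤ s) :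
    burgeTerm p M e s (s + e - 2 * m) = (-1) ^ (s + e) * ∑ i ∈ range (M + 1),
      p ^ ((s : ℤ) ^ 2 + s - s * (s - M + i) + (s - M + i) ^ 2) * gb p (s + i) i *
        (p ^ (2 * (m : ℤ) ^ 2 - 2 * s * m - 2 * m) *
          (gb p (s + 2 * e - m) (m - (s - M + i)) * gb p (m - 2 * e) (s - m - (s - M + i)))) := by
  have hb := burge hp (B := M + 1) (a := s + 2 * e - m) (c := m - 2 * e) (k := M - s + m)
    (l := M - m) (by push_cast; omega) (by
      by_cases h : 0 ≤ (m : ℤ) - 2 * e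
      · exact Or.inl (by omega)
      · exact Or.inr (gb_mul_gb_eq_zero p (by omega)))
  have h2 : (s : ℤ) + (s + e - 2 * m) + e = 2 * (s + e - m) := by ring
  rw [burgeTerm, if_pos (h2 ▸ even_two_mul _),
    show ((s : ℤ) - 3 * (s + e - 2 * m) - e) / 2 = 3 * m - s - 2 * e by omega,
    show ((s : ℤ) + 3 * (s + e - 2 * m) + e) / 2 = 2 * s + 2 * e - 3 * m by omega,
    gb_symm hp _ (3 * m - s - 2 * e), gb_symm hp _ (2 * s + 2 * e - 3 * m),
    show (M : ℤ) - (s + e - 2 * m) - e - (3 * m - s - 2 * e) = M - m by ring,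
    show (M : ℤ) + (s + e - 2 * m) + e - (2 * s + 2 * e - 3 * m) = M - s + m by ring,
    show (M : ℤ) - (s + e - 2 * m) - e = m - 2 * e + (M - s + m) by ring,
    show (M : ℤ) + (s + e - 2 * m) + e = s + 2 * e - m + (M - m) by ring,
    mul_comm (gb p (m - 2 * e + (M - s + m)) _), hb, burgeSum, neg_one_zpow_sub_two_mul, mul_assoc,
    mul_sum]
  congr 1
  refine sum_congr rfl fun i _ => ?_
  rw [show (s : ℤ) + 2 * e - m + (m - 2 * e) + i = s + i by ring,
    show (M : ℤ) - s + m - i = m - (s - M + i) by ring,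
    show (M : ℤ) - m - i = s - m - (s - M + i) by ring]
  have hw : p ^ (((s : ℤ) + e - 2 * m) * (3 * (s + e - 2 * m) + 1) +
      (3 * m - s - 2 * e) * (2 * s + 2 * e - 3 * m)) *
        p ^ (((m : ℤ) - (s - M + i)) * (s - m - (s - M + i))) =
      p ^ ((s : ℤ) ^ 2 + s - s * (s - M + i) + (s - M + i) ^ 2) *
        p ^ (2 * (m : ℤ) ^ 2 - 2 * s * m - 2 * m) := by
    rw [← zpow_add₀ hp.1, ← zpow_add₀ hp.1]
    congr 1
    rcases he with rfl | rfl <;> ring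
  linear_combination (gb p (s + i) i * gb p (s + 2 * e - m) (m - (s - M + i)) *
    gb p (m - 2 * e) (s - m - (s - M + i))) * hw

lemma sum_burgeTerm_of_two_le {p : K} (hp : Generic p) (M : ℕ) {s : ℕ} (hs : 2 ≤ s) :
    ∑ j ∈ Icc (-(M : ℤ)) M, (burgeTerm p M 0 s j + burgeTerm p M 1 s j) =
      p ^ s.choose 2 * gb p (M + 1) s := by
  have hsum : ∑ j ∈ Icc (-(M : ℤ)) M, (burgeTerm p M 0 s j + burgeTerm p M 1 s j) =
      (-1) ^ s * ∑ i ∈ range (M + 1),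
        p ^ ((s : ℤ) ^ 2 + s - s * (s - M + i) + (s - M + i) ^ 2) * gb p (s + i) i *
          innerSum p s (s - M + i) := by
    rw [sum_add_distrib, sum_burgeTerm_reindex p M s (Or.inl rfl),
      sum_burgeTerm_reindex p M s (Or.inr rfl), ← sum_add_distrib]
    simp only [innerSum, mul_sum]
    rw [sum_comm]
    refine sum_congr rfl fun m hm => ?_
    have hm' : m ≤ s := Nat.lt_succ_iff.1 (mem_range.1 hm)
    rw [burgeTerm_eq_sum hp (Or.inl rfl) hs hm', burgeTerm_eq_sum hp (Or.inr rfl) hs hm',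
      mul_sum, mul_sum, ← sum_add_distrib]
    refine sum_congr rfl fun i _ => ?_
    rw [add_zero, zpow_add_one₀ (by simp), zpow_natCast, mul_zero, add_zero, sub_zero, mul_one]
    ring
  have hi : ∀ i : ℕ, (s : ℤ) - M + i ≠ 1 → innerSum p s (s - M + i) = 0 := by
    intro i hi
    rcases lt_trichotomy ((s : ℤ) - M + i) 0 with h | h | h
    · exact innerSum_of_neg p s h
    · rw [h, innerSum_zero hp (by omega)]
    · obtain ⟨n, hn⟩ := Int.eq_ofNat_of_zero_le (show 0 ≤ (s : ℤ) - M + i - 2 by omega)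
      rw [show (s : ℤ) - M + i = n + 2 by omega, innerSum_of_two_le hp]
  rw [hsum]
  rcases le_or_gt s (M + 1) with h | h
  · obtain ⟨r, hr⟩ := Nat.exists_eq_add_of_le h
    rw [sum_eq_single_of_mem r (mem_range.2 (by omega)) fun i _ hir => by
      rw [hi i (by omega), mul_zero], show (s : ℤ) - M + r = 1 by omega, innerSum_one hp hs,
      show (M : ℤ) + 1 = s + r by omega, gb_symm hp _ s, add_sub_cancel_left]
    have hw : p ^ ((s : ℤ) ^ 2 + s - s * 1 + 1 ^ 2) * p ^ (-((s + 1).choose 2 + 1 : ℤ)) =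
        p ^ s.choose 2 := by
      rw [← zpow_add₀ hp.1, ← zpow_natCast]
      congr 1
      have h1 := two_mul_choose_two s
      have h2 := two_mul_choose_two (s + 1)
      push_cast at h2
      linarith
    have hone : (-1 : K) ^ s * (-1) ^ s = 1 := by rw [← mul_pow]; simp
    linear_combination gb p (s + r) r * (-1 : K) ^ s * (-1) ^ s * hw +
      p ^ s.choose 2 * gb p (s + r) r * hone
  · rw [gb_of_lt p (by omega), sum_eq_zero fun i _ => by rw [hi i (by omega), mul_zero]]
    simp

/-- The sum over `j` of all the terms left over by Burge's transform. -/
lemma sum_burgeTerm {p : K} (hp : Generic p) {M : ℕ} (hM : 1 ≤ M) (s : ℕ) :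
    ∑ j ∈ Icc (-(M : ℤ)) M, (burgeTerm p M 0 s j + burgeTerm p M 1 s j) =
      p ^ s.choose 2 * gb p (M + 1) s := by
  rcases lt_or_ge s 2 with hs | hs
  · rw [sum_eq_single_of_mem 0 (mem_Icc.2 (by omega))]
    · interval_cases s
      · rw [burgeTerm_eq_zero (e := 1) (by simp [Int.even_iff])]
        simp [burgeTerm, gb_zero_right (show (0 : ℤ) ≤ M by omega),
          gb_zero_right (show (0 : ℤ) ≤ M + 1 by omega)]
      · rw [burgeTerm_eq_zero (e := 0) (by simp [Int.even_iff])]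
        simp [burgeTerm, gb_zero_right (show (0 : ℤ) ≤ M - 1 by omega)]
    · intro j _ hj
      rw [burgeTerm_eq_zero, burgeTerm_eq_zero, add_zero] <;> omega
  · exact sum_burgeTerm_of_two_le hp M hs

lemma sum_burgeTerm_of_neg (p : K) (M : ℕ) {s : ℤ} (hs : s < 0) :
    ∑ j ∈ Icc (-(M : ℤ)) M, (burgeTerm p M 0 s j + burgeTerm p M 1 s j) = 0 :=
  sum_eq_zero fun j _ => by
    rw [burgeTerm_eq_zero, burgeTerm_eq_zero, add_zero] <;> omega

lemma mul_trinomial_summand_eq {t : K} (hp : Generic (t ^ 2)) {M : ℕ} (hM : 1 ≤ M) {j e : ℤ}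
    (he : e = 0 ∨ e = 1) (hj : j ∈ Icc (-(M : ℤ)) M) (L n : ℕ) :
    (-1 : K) ^ j * (t ^ 2) ^ (j * (3 * j + 1)) *
      (if Even ((n : ℤ) + (3 * j + e) + L) then
        t ^ ((n : ℤ) ^ 2) * gb (t ^ 2) M n *
          gb (t ^ 2) (M + 2 * j + (L - (3 * j + e) - n) / 2) (M + 2 * j) *
          gb (t ^ 2) (M - 2 * j + (L + (3 * j + e) - n) / 2) (M - 2 * j)
      else 0) =
    t ^ ((n : ℤ) ^ 2) * gb (t ^ 2) M n * ∑ i ∈ range (L + 3 * M + 2),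
      gb (t ^ 2) (2 * M + i) i * burgeTerm (t ^ 2) M e (L - n - 2 * i) j := by
  obtain ⟨hj1, hj2⟩ := mem_Icc.1 hj
  split_ifs with h
  · obtain ⟨r, hr⟩ := h
    obtain ⟨k, rfl⟩ : ∃ k, r = n + 3 * j + e + k := ⟨r - n - 3 * j - e, by ring⟩
    have hb := burge hp (B := L + 3 * M + 2) (a := M - j - e) (c := M + j + e) (k := k)
      (l := k + 3 * j + e) (by push_cast; omega) (by
        by_cases h : 0 ≤ (M : ℤ) - j - e
        · exact Or.inl (by omega)
        · exact Or.inr (gb_mul_gb_eq_zero _ (by omega)))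
    rw [show ((L : ℤ) - (3 * j + e) - n) / 2 = k by omega,
      show ((L : ℤ) + (3 * j + e) - n) / 2 = k + 3 * j + e by omega,
      gb_symm hp _ (M + 2 * j), gb_symm hp _ (M - 2 * j), add_sub_cancel_left, add_sub_cancel_left,
      mul_assoc _ (gb _ _ k), show (M : ℤ) + 2 * j + k = M - j - e + (k + 3 * j + e) by ring,
      show (M : ℤ) - 2 * j + (k + 3 * j + e) = M + j + e + k by ring, hb, burgeSum,
      mul_sum, mul_sum, mul_sum]
    refine sum_congr rfl fun i _ => ?_
    have hpar : (L : ℤ) - n - 2 * i + j + e = 2 * (k + 2 * j + e - i) := by omega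
    rw [burgeTerm, if_pos (hpar ▸ even_two_mul _),
      show ((L : ℤ) - n - 2 * i - 3 * j - e) / 2 = k - i by omega,
      show ((L : ℤ) - n - 2 * i + 3 * j + e) / 2 = k + 3 * j + e - i by omega,
      zpow_add₀ hp.1, show (M : ℤ) - j - e + (M + j + e) + i = 2 * M + i by ring]
    ring
  · rw [mul_zero, sum_eq_zero, mul_zero]
    intro i _
    rw [burgeTerm, if_neg, mul_zero]
    rintro ⟨r, hr⟩
    exact h ⟨r + n + i + j, by omega⟩

/-- Burge's transform applied to the left-hand side of the identity. -/
lemma sum_mul_Uq_eq {t : K} (hp : Generic (t ^ 2)) {M : ℕ} (hM : 1 ≤ M) (L : ℕ) :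
    ∑ j ∈ Icc (-(M : ℤ)) M,
      (-1 : K) ^ j * (t ^ 2) ^ (j * (3 * j + 1)) * Uq t L M (3 * j) (2 * j) =
    ∑ n ∈ range (L + 1), t ^ ((n : ℤ) ^ 2) * gb (t ^ 2) M n * ∑ i ∈ range (L + 3 * M + 2),
      gb (t ^ 2) (2 * M + i) i * ∑ j ∈ Icc (-(M : ℤ)) M,
        (burgeTerm (t ^ 2) M 0 (L - n - 2 * i) j + burgeTerm (t ^ 2) M 1 (L - n - 2 * i) j) := by
  have h : ∀ j ∈ Icc (-(M : ℤ)) M,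
      (-1 : K) ^ j * (t ^ 2) ^ (j * (3 * j + 1)) * Uq t L M (3 * j) (2 * j) =
      ∑ n ∈ range (L + 1), t ^ ((n : ℤ) ^ 2) * gb (t ^ 2) M n * ∑ i ∈ range (L + 3 * M + 2),
        gb (t ^ 2) (2 * M + i) i *
        (burgeTerm (t ^ 2) M 0 (L - n - 2 * i) j + burgeTerm (t ^ 2) M 1 (L - n - 2 * i) j) := by
    intro j hj
    rw [Uq, Trf, Trf, ← sum_add_distrib, mul_sum, Int.toNat_natCast]
    refine sum_congr rfl fun n _ => ?_
    have h0 := mul_trinomial_summand_eq hp hM (Or.inl rfl) hj L n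
    have h1 := mul_trinomial_summand_eq hp hM (Or.inr rfl) hj L n
    rw [add_zero] at h0
    rw [mul_add, h0, h1, ← mul_add, ← sum_add_distrib]
    simp only [mul_add]
  rw [sum_congr rfl h, sum_comm]
  refine sum_congr rfl fun n _ => ?_
  rw [← mul_sum, sum_comm]
  simp only [mul_sum]

/-- The power series `∑_i [N+i choose i]_p X^(d i)`. -/
def gbSeries (p : K) (d N : ℕ) : PowerSeries K :=
  PowerSeries.mk fun k => if d ∣ k then gb p ((N : ℤ) + (k / d : ℕ)) (k / d : ℕ) else 0

lemma coeff_mul_one_sub_X_pow (f : PowerSeries K) (c : K) {d : ℕ} (k : ℕ) :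
    PowerSeries.coeff k (f * (1 - PowerSeries.C c * PowerSeries.X ^ d)) =
      PowerSeries.coeff k f - c * if d ≤ k then PowerSeries.coeff (k - d) f else 0 := by
  rw [mul_sub, mul_one, map_sub, mul_left_comm, PowerSeries.coeff_C_mul,
    PowerSeries.coeff_mul_X_pow']

lemma coeff_gbSeries (p : K) {d : ℕ} (hd : 0 < d) (N i : ℕ) :
    PowerSeries.coeff (d * i) (gbSeries p d N) = gb p ((N : ℤ) + i) i := by
  rw [gbSeries, PowerSeries.coeff_mk, if_pos (dvd_mul_right _ _), Nat.mul_div_cancel_left _ hd]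

lemma coeff_gbSeries_of_not_dvd (p : K) {d k : ℕ} (h : ¬ d ∣ k) (N : ℕ) :
    PowerSeries.coeff k (gbSeries p d N) = 0 := by
  rw [gbSeries, PowerSeries.coeff_mk, if_neg h]

lemma coeff_gbSeries_mul_one_sub (p c : K) {d : ℕ} (hd : 0 < d) (N k : ℕ) :
    PowerSeries.coeff k (gbSeries p d N * (1 - PowerSeries.C c * PowerSeries.X ^ d)) =
      if d ∣ k then gb p ((N : ℤ) + (k / d : ℕ)) (k / d : ℕ) -
        c * gb p ((N : ℤ) + (k / d : ℕ) - 1) ((k / d : ℕ) - 1) else 0 := by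
  rw [coeff_mul_one_sub_X_pow]
  split_ifs with h1 h2 h2
  · obtain ⟨i, rfl⟩ := h2
    obtain ⟨i, rfl⟩ : ∃ u, i = u + 1 := Nat.exists_eq_add_one.2 (Nat.pos_of_mul_pos_left
      (hd.trans_le h1))
    rw [mul_add_one, Nat.add_sub_cancel, ← mul_add_one, coeff_gbSeries p hd, coeff_gbSeries p hd,
      Nat.mul_div_cancel_left _ hd]
    push_cast
    rw [add_sub_cancel_right, ← add_assoc, add_sub_cancel_right]
  · rw [coeff_gbSeries_of_not_dvd p h2, coeff_gbSeries_of_not_dvd p fun h =>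
      h2 (Nat.sub_add_cancel h1 ▸ dvd_add h dvd_rfl), mul_zero, sub_zero]
  · obtain rfl := Nat.eq_zero_of_dvd_of_lt h2 (not_le.1 h1)
    have := coeff_gbSeries p hd N 0
    rw [mul_zero] at this
    rw [this, Nat.zero_div, gb_of_neg (k := ((0 : ℕ) : ℤ) - 1) p (by simp)]
  · rw [coeff_gbSeries_of_not_dvd p h2, mul_zero, sub_zero]

lemma gbSeries_mul_prod {p : K} (hp : Generic p) {d : ℕ} (hd : 0 < d) (N : ℕ) :
    gbSeries p d N *
      ∏ i ∈ range (N + 1), (1 - PowerSeries.C (p ^ i) * PowerSeries.X ^ d) = 1 := by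
  induction N with
  | zero =>
    rw [prod_range_one]
    ext k
    rw [coeff_gbSeries_mul_one_sub p _ hd, PowerSeries.coeff_one]
    by_cases h : d ∣ k
    · obtain ⟨i, rfl⟩ := h
      rw [if_pos (dvd_mul_right _ _), Nat.mul_div_cancel_left _ hd]
      rcases i with _ | i
      · simp [gb_zero_right, gb_of_neg]
      · rw [if_neg (by positivity), Nat.cast_zero, zero_add, pow_zero, gb_self hp (by omega),
          gb_self hp (by omega), mul_one, sub_self]
    · have h0 : k ≠ 0 := by rintro rfl; exact h (dvd_zero d)
      rw [if_neg h, if_neg h0]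
  | succ N ih =>
    have hrec : gbSeries p d (N + 1) * (1 - PowerSeries.C (p ^ (N + 1)) * PowerSeries.X ^ d) =
        gbSeries p d N := by
      ext k
      rw [coeff_gbSeries_mul_one_sub p _ hd, gbSeries, PowerSeries.coeff_mk]
      refine if_congr Iff.rfl ?_ rfl
      have h := gb_pascal hp (le_add_of_le_of_nonneg (show (1 : ℤ) ≤ ((N + 1 : ℕ) : ℤ) by omega)
        (Int.natCast_nonneg (k / d))) (k / d : ℕ)
      rw [add_sub_cancel_right, zpow_natCast] at h
      rw [h, add_sub_cancel_right]
      congr 1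
      push_cast
      ring
    rw [prod_range_succ, mul_comm (∏ i ∈ range (N + 1), _), ← mul_assoc, hrec, ih]

lemma qProd_succ (p a : K) (n : ℕ) :
    qProd p a (n + 1) = qProd p a n * (1 + Polynomial.C (a * p ^ n) * Polynomial.X) :=
  prod_range_succ _ _

lemma qProd_mul_qProd_sq (t : K) (M : ℕ) :
    qProd (t ^ 2) t M * qProd (t ^ 2) 1 (M + 1) = qProd t 1 (2 * M + 1) := by
  induction M with
  | zero => simp [qProd]
  | succ M ih =>
    rw [show 2 * (M + 1) + 1 = 2 * M + 1 + 1 + 1 by ring, qProd_succ t, qProd_succ t, ← ih,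
      qProd_succ _ _ M, qProd_succ _ _ (M + 1), show (1 : K) * t ^ (2 * M + 1) = t * (t ^ 2) ^ M by
        ring, show (1 : K) * t ^ (2 * M + 1 + 1) = 1 * (t ^ 2) ^ (M + 1) by ring]
    ring

lemma coe_qProd (t : K) (N : ℕ) : (qProd t 1 N : PowerSeries K) =
    ∏ i ∈ range N, (1 + PowerSeries.C (t ^ i) * PowerSeries.X) := by
  rw [qProd, ← Polynomial.coeToPowerSeries.ringHom_apply, map_prod]
  refine prod_congr rfl fun i _ => ?_
  simp

lemma qProd_mul_gbSeries {t : K} (ht : Generic t) (ht2 : Generic (t ^ 2)) (N : ℕ) :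
    (qProd t 1 (N + 1) : PowerSeries K) * gbSeries (t ^ 2) 2 N = gbSeries t 1 N := by
  have h1 := gbSeries_mul_prod ht one_pos N
  have h2 := gbSeries_mul_prod ht2 two_pos N
  have h : (∏ i ∈ range (N + 1), (1 - PowerSeries.C ((t ^ 2) ^ i) * PowerSeries.X ^ 2)) =
      (qProd t 1 (N + 1) : PowerSeries K) *
      ∏ i ∈ range (N + 1), (1 - PowerSeries.C (t ^ i) * PowerSeries.X ^ 1) := by
    rw [coe_qProd, ← prod_mul_distrib]
    refine prod_congr rfl fun i _ => ?_
    rw [pow_right_comm, map_pow _ _ 2]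
    ring
  rw [h] at h2
  linear_combination gbSeries t 1 N * h2 -
    (qProd t 1 (N + 1) : PowerSeries K) * gbSeries (t ^ 2) 2 N * h1

lemma sum_gb_mul_eq_coeff (p : K) (N B m : ℕ) (hB : m < B) (f : PowerSeries K) (S : ℤ → K)
    (hS : ∀ n : ℕ, S n = PowerSeries.coeff n f) (hS' : ∀ n < 0, S n = 0) :
    ∑ i ∈ range B, gb p ((N : ℤ) + i) i * S (m - 2 * i) =
      PowerSeries.coeff m (gbSeries p 2 N * f) := by
  rw [PowerSeries.coeff_mul, Finset.Nat.sum_antidiagonal_eq_sum_range_succ_mk]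
  refine sum_bij_ne_zero (fun i _ _ => 2 * i) ?_ ?_ ?_ ?_
  · intro i _ h
    by_contra hi
    rw [mem_range] at hi
    exact h (by rw [hS' _ (by omega), mul_zero])
  · intro i _ _ i' _ _ h
    omega
  · intro k hk h
    have hk' := mem_range.1 hk
    by_cases h2 : 2 ∣ k
    · obtain ⟨i, rfl⟩ := h2
      refine ⟨i, mem_range.2 (by omega), ?_, rfl⟩
      rw [← coeff_gbSeries p two_pos, show (m : ℤ) - 2 * i = (m - 2 * i : ℕ) by omega, hS]
      exact h
    · exact absurd (by rw [coeff_gbSeries_of_not_dvd p h2, zero_mul]) h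
  · intro i _ h
    have hi : 2 * i ≤ m := by
      by_contra hi
      exact h (by rw [hS' _ (by omega), mul_zero])
    rw [coeff_gbSeries p two_pos, show (m : ℤ) - 2 * i = (m - 2 * i : ℕ) by omega, hS]

lemma generic_tq_pow {k : ℕ} (hk : 0 < k) : Generic (tq ^ k) := by
  refine ⟨pow_ne_zero _ RatFunc.X_ne_zero, fun n hn h => ?_⟩
  rw [← pow_mul, tq, ← RatFunc.algebraMap_X, ← map_pow, ← map_one (algebraMap (Polynomial ℚ) _)] at h
  have := congrArg Polynomial.natDegree (RatFunc.algebraMap_injective ℚ h)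
  rw [Polynomial.natDegree_X_pow, Polynomial.natDegree_one] at this
  exact (Nat.mul_pos hk hn).ne' this

lemma Uq_zero (t : K) (L : ℕ) : Uq t L 0 0 0 = 1 := by
  have h : ∀ e : ℤ, (e = 0 ∨ e = 1) → Trf t L 0 e 0 = if Even (e + L) then 1 else 0 := by
    intro e he
    rw [Trf, sum_eq_single_of_mem 0 (by simp) fun n _ hn => by
      rw [gb_of_lt (k := (n : ℤ)) _ (by omega)]; simp]
    rw [Nat.cast_zero, zero_add]
    split_ifs with h
    · obtain ⟨r, hr⟩ := h
      simp only [add_zero, sub_zero, zero_add]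
      rw [gb_zero_right le_rfl, gb_zero_right (by omega), gb_zero_right (by omega)]
      simp
    · rfl
  rw [Uq, h 0 (Or.inl rfl), zero_add, zero_add, h 1 (Or.inr rfl)]
  by_cases hL : Even (L : ℤ)
  · simp [hL, Int.even_add]
  · simp [hL, Int.even_add]

/-- Refined Bailey pair C(1):
`Σ_{j∈ℤ} (-1)^j q^{j(3j+1)} U(L,M,3j,2j) = [L+2M choose L]_{q^{1/2}}`
(terms with `|2j| > M` vanish; stated with `t = q^{1/2}`, so `q = t^2` and the
right side is the Gaussian binomial in base `t`). -/
theorem refined_C1 (L M : ℕ) :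
    ∑ j ∈ Finset.Icc (-(M : ℤ)) M,
      (-1 : K) ^ j * (tq ^ 2) ^ (j * (3 * j + 1)) * Uq tq L M (3 * j) (2 * j) =
      gb tq ((L : ℤ) + 2 * M) L := by
  have ht : Generic tq := pow_one tq ▸ generic_tq_pow one_pos
  have ht2 : Generic (tq ^ 2) := generic_tq_pow two_pos
  rcases Nat.eq_zero_or_pos M with rfl | hM
  · have := Uq_zero tq L
    simp [this, gb_self ht]
  set S : ℤ → K := fun s => ∑ j ∈ Icc (-(M : ℤ)) M,
    (burgeTerm (tq ^ 2) M 0 s j + burgeTerm (tq ^ 2) M 1 s j)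
  have hS : ∀ n : ℕ, S n =
      PowerSeries.coeff n (qProd (tq ^ 2) 1 (M + 1) : PowerSeries K) := by
    intro n
    rw [Polynomial.coeff_coe, coeff_qProd ht2, one_pow, mul_one]
    exact sum_burgeTerm ht2 hM n
  have hS' : ∀ s < 0, S s = 0 := fun s hs => sum_burgeTerm_of_neg _ M hs
  have hT : ∀ n : ℕ, tq ^ ((n : ℤ) ^ 2) * gb (tq ^ 2) M n =
      PowerSeries.coeff n (qProd (tq ^ 2) tq M : PowerSeries K) := by
    intro n
    rw [Polynomial.coeff_coe, coeff_qProd ht2, ← pow_mul, ← pow_add,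
      ← zpow_natCast tq (2 * n.choose 2 + n)]
    congr 2
    have := two_mul_choose_two n
    push_cast
    linarith
  have hprod : (qProd (tq ^ 2) tq M : PowerSeries K) *
      (gbSeries (tq ^ 2) 2 (2 * M) * (qProd (tq ^ 2) 1 (M + 1) : PowerSeries K)) =
      gbSeries tq 1 (2 * M) := by
    rw [← qProd_mul_gbSeries ht ht2, ← qProd_mul_qProd_sq, Polynomial.coe_mul]
    ring
  have hL := coeff_gbSeries tq one_pos (2 * M) L
  rw [one_mul, ← hprod, PowerSeries.coeff_mul,
    Finset.Nat.sum_antidiagonal_eq_sum_range_succ_mk] at hL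
  push_cast at hL
  rw [sum_mul_Uq_eq ht2 hM, add_comm (L : ℤ), ← hL]
  refine sum_congr rfl fun n hn => ?_
  have hn' : n ≤ L := Nat.lt_succ_iff.1 (mem_range.1 hn)
  rw [hT, ← sum_gb_mul_eq_coeff (tq ^ 2) (2 * M) (L + 3 * M + 2) (L - n) (by omega) _ S hS hS']
  push_cast [Nat.cast_sub hn']
  rfl
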